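/- arXiv:2512.21088 — 3 statements merged into one kernel-verified Lean document; each statement's English description precedes it below -/
import Mathlib

section
/- Let N ≥ 2 be an integer, let τ be a point of the complex upper half-plane with E₂^{(N)}(τ) ≠ 0, and let γ = [[a,b],[c,d]] ∈ Γ₀(N). Then E₂^{(N)}(γτ) ≠ 0, and a₄(γτ) = a₄(τ) and a₆(γτ) = a₆(τ); that is, the functions a₄ and a₆ are invariant under the action of Γ₀(N). -/
open Complex UpperHalfPlane Matrix MatrixGroups Filter

/-- `q = e^{2πiτ}`. -/
noncomputable def qExp (τ : ℂ) : ℂ := Complex.exp (2 * Real.pi * Complex.I * τ)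

/-- `σ_k(n) = Σ_{d ∣ n} d^k`. -/
def sigma' (k n : ℕ) : ℕ := ∑ d ∈ n.divisors, d ^ k

/-- Normalized Eisenstein series `E₄(τ) = 1 + 240 Σ_{n≥1} σ₃(n) qⁿ`. -/
noncomputable def E4 (τ : ℂ) : ℂ := 1 + 240 * ∑' n : ℕ+, (sigma' 3 n : ℂ) * qExp τ ^ (n : ℕ)

/-- Normalized Eisenstein series `E₆(τ) = 1 − 504 Σ_{n≥1} σ₅(n) qⁿ`. -/
noncomputable def E6 (τ : ℂ) : ℂ := 1 - 504 * ∑' n : ℕ+, (sigma' 5 n : ℂ) * qExp τ ^ (n : ℕ)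

/-- Normalized weight-2 Eisenstein series `E₂(τ) = 1 − 24 Σ_{n≥1} σ₁(n) qⁿ`. -/
noncomputable def E2 (τ : ℂ) : ℂ := 1 - 24 * ∑' n : ℕ+, (sigma' 1 n : ℂ) * qExp τ ^ (n : ℕ)

/-- `E₂^{(N)}(τ) = (N−1)/24 + Σ_{n≥1} σ₁(n)(qⁿ − N q^{Nn})`. -/
noncomputable def E2N (N : ℕ) (τ : ℂ) : ℂ :=
  ((N : ℂ) - 1) / 24 +
    ∑' n : ℕ+, (sigma' 1 n : ℂ) * (qExp τ ^ (n : ℕ) - (N : ℂ) * qExp τ ^ (N * (n : ℕ)))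

/-- `a₄(τ) = −E₄(τ)/(48 E₂^{(N)}(τ)²)`. -/
noncomputable def a4 (N : ℕ) (τ : ℂ) : ℂ := -E4 τ / (48 * E2N N τ ^ 2)

/-- `a₆(τ) = E₆(τ)/(864 E₂^{(N)}(τ)³)`. -/
noncomputable def a6 (N : ℕ) (τ : ℂ) : ℂ := E6 τ / (864 * E2N N τ ^ 3)

/-- `a₄′(τ) = −E₄(Nτ)/(48 E₂^{(N)}(τ)²)`. -/
noncomputable def a4' (N : ℕ) (τ : ℂ) : ℂ := -E4 ((N : ℂ) * τ) / (48 * E2N N τ ^ 2)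

/-- `a₆′(τ) = E₆(Nτ)/(864 E₂^{(N)}(τ)³)`. -/
noncomputable def a6' (N : ℕ) (τ : ℂ) : ℂ := E6 ((N : ℂ) * τ) / (864 * E2N N τ ^ 3)

lemma aux_sigma (k n : ℕ) : sigma' k n = ArithmeticFunction.sigma k n := by
  simp [sigma', ArithmeticFunction.sigma_apply]

lemma aux_bern4 : bernoulli 4 = -1 / 30 := by
  rw [bernoulli_eq_bernoulli'_of_ne_one (by norm_num), bernoulli'_four]

lemma aux_bern6 : bernoulli 6 = 1 / 42 := by
  rw [bernoulli_eq_bernoulli'_of_ne_one (by norm_num)]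
  have h5 : bernoulli' 5 = 0 := bernoulli'_eq_zero_of_odd (by decide) (by norm_num)
  rw [bernoulli'_def]
  simp [Finset.sum_range_succ, h5, Nat.choose]
  norm_num

lemma aux_E4 (z : ℍ) : E4 z = ModularForm.E₄ z := by
  have := EisensteinSeries.q_expansion_bernoulli (k := 4) (by norm_num) (by decide) z
  rw [ModularForm.E₄, this, E4, aux_bern4]
  simp only [aux_sigma, qExp, zpow_natCast]
  push_cast
  norm_num

lemma aux_E6 (z : ℍ) : E6 z = ModularForm.E₆ z := by
  have := EisensteinSeries.q_expansion_bernoulli (k := 6) (by norm_num) (by decide) z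
  rw [ModularForm.E₆, this, E6, aux_bern6]
  simp only [aux_sigma, qExp, zpow_natCast]
  push_cast
  norm_num

lemma aux_E2 (z : ℍ) : E2 z = EisensteinSeries.E2 z := by
  rw [EisensteinSeries.E2_eq_tsum_cexp, E2]
  simp only [aux_sigma, qExp]

lemma aux_E4_transform (γ : SL(2, ℤ)) (z : ℍ) :
    E4 (γ • z : ℍ) = denom γ z ^ 4 * E4 z := by
  rw [aux_E4, aux_E4]
  have := SlashInvariantForm.slash_action_eqn'' (Γ := 𝒮ℒ) ModularForm.E₄
    (γ := Matrix.SpecialLinearGroup.mapGL ℝ γ) ⟨γ, rfl⟩ z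
  exact_mod_cast this

lemma aux_E6_transform (γ : SL(2, ℤ)) (z : ℍ) :
    E6 (γ • z : ℍ) = denom γ z ^ 6 * E6 z := by
  rw [aux_E6, aux_E6]
  have := SlashInvariantForm.slash_action_eqn'' (Γ := 𝒮ℒ) ModularForm.E₆
    (γ := Matrix.SpecialLinearGroup.mapGL ℝ γ) ⟨γ, rfl⟩ z
  exact_mod_cast this

lemma aux_E2_transform (γ : SL(2, ℤ)) (z : ℍ) :
    E2 (γ • z : ℍ) = denom γ z ^ 2 * E2 z
      - (1 / (2 * riemannZeta 2)) * (2 * Real.pi * Complex.I) * γ 1 0 * denom γ z := by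
  rw [aux_E2, aux_E2]
  have h := congrFun (EisensteinSeries.E2_slash_action γ) z
  have hd := denom_ne_zero γ z
  rw [ModularForm.SL_slash_apply] at h
  simp only [Pi.sub_apply, Pi.smul_apply, smul_eq_mul, EisensteinSeries.D2, _root_.zpow_neg] at h
  rw [← div_eq_mul_inv, div_eq_iff (zpow_ne_zero _ hd)] at h
  rw [h, zpow_ofNat]
  field_simp

lemma aux_summable (z : ℍ) :
    Summable fun n : ℕ+ => (sigma' 1 n : ℂ) * qExp z ^ (n : ℕ) := by
  have := EisensteinSeries.summable_sigma_mul_cexp_pow (k := 2) (by norm_num) z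
  simpa only [aux_sigma, qExp] using! this.comp_injective PNat.coe_injective

lemma aux_E2N (N : ℕ) (z w : ℍ) (hw : (w : ℂ) = N * z) :
    E2N N z = -(E2 z - N * E2 w) / 24 := by
  have hq : ∀ n : ℕ, qExp z ^ (N * n) = qExp w ^ n := by
    intro n
    rw [pow_mul]
    congr 1
    rw [qExp, qExp, hw, ← Complex.exp_nat_mul]
    congr 1
    ring
  have h : (∑' n : ℕ+, (sigma' 1 n : ℂ) * (qExp z ^ (n : ℕ) - (N : ℂ) * qExp z ^ (N * (n : ℕ))))
      = (∑' n : ℕ+, (sigma' 1 n : ℂ) * qExp z ^ (n : ℕ))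
        - N * ∑' n : ℕ+, (sigma' 1 n : ℂ) * qExp w ^ (n : ℕ) := by
    rw [← tsum_mul_left, ← (aux_summable z).tsum_sub ((aux_summable w).mul_left _)]
    refine tsum_congr fun n => ?_
    rw [hq]
    ring
  rw [E2N, h, E2, E2]
  ring

lemma aux_E2N_transform (N : ℕ) (hN : 2 ≤ N) (z : ℍ) (γ : SL(2, ℤ))
    (hγ : γ ∈ CongruenceSubgroup.Gamma0 N) :
    E2N N (γ • z : ℍ) = denom γ z ^ 2 * E2N N z := by
  have hN0 : (N : ℂ) ≠ 0 := by
    have : N ≠ 0 := by omega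
    exact_mod_cast this
  have hNp : 0 < (N : ℝ) := by
    have : 0 < N := by omega
    exact_mod_cast this
  rw [CongruenceSubgroup.Gamma0_mem, ZMod.intCast_zmod_eq_zero_iff_dvd] at hγ
  obtain ⟨c, hc⟩ := hγ
  have hdet := γ.det_coe
  rw [Matrix.det_fin_two] at hdet
  let γ' : SL(2, ℤ) := ⟨!![γ 0 0, N * γ 0 1; c, γ 1 1], by
    rw [Matrix.det_fin_two_of]; rw [hc] at hdet; linarith⟩
  have him (u : ℍ) : 0 < ((N : ℂ) * u).im := by
    simpa using mul_pos hNp u.im_pos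
  let w : ℍ := ⟨N * z, him z⟩
  have hw : (w : ℂ) = N * z := rfl
  have hden : denom γ' w = denom γ z := by
    rw [ModularGroup.denom_apply, ModularGroup.denom_apply, hw, hc]
    simp [γ']
    ring
  have hw' : ((γ' • w : ℍ) : ℂ) = N * (γ • z : ℍ) := by
    have hd := denom_ne_zero γ z
    rw [ModularGroup.denom_apply] at hd
    have hd' := denom_ne_zero γ' w
    rw [ModularGroup.denom_apply] at hd'
    rw [UpperHalfPlane.coe_specialLinearGroup_apply, UpperHalfPlane.coe_specialLinearGroup_apply]
    rw [ModularGroup.denom_apply, ModularGroup.denom_apply] at hden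
    simp at hden hd hd' ⊢
    rw [hden, hw]
    simp [γ']
    ring
  rw [aux_E2N N _ _ hw', aux_E2N N _ _ hw, aux_E2_transform, aux_E2_transform, hden, hc]
  simp [γ']
  ring

/-- `a₄` and `a₆` are invariant under the Möbius action of `Γ₀(N)`, and the nonvanishing of
`E₂^{(N)}` is preserved. -/
theorem a4_a6_Gamma0_invariant (N : ℕ) (hN : 2 ≤ N) (τ : ℍ)
    (hτ : E2N N (τ : ℂ) ≠ 0) (γ : CongruenceSubgroup.Gamma0 N) :
    E2N N (((γ : SL(2, ℤ)) • τ : ℍ) : ℂ) ≠ 0 ∧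
    a4 N (((γ : SL(2, ℤ)) • τ : ℍ) : ℂ) = a4 N (τ : ℂ) ∧
    a6 N (((γ : SL(2, ℤ)) • τ : ℍ) : ℂ) = a6 N (τ : ℂ) := by
  have hd := denom_ne_zero (γ : SL(2, ℤ)) τ
  have h2 := aux_E2N_transform N hN τ γ γ.2
  refine ⟨?_, ?_, ?_⟩
  · rw [h2]
    exact mul_ne_zero (pow_ne_zero _ hd) hτ
  · rw [a4, a4, h2, aux_E4_transform]
    field_simp
  · rw [a6, a6, h2, aux_E6_transform]
    field_simp
end

section
/- Let N ≥ 2 be an integer. For every τ in the complex upper half-plane, E₂^{(N)}(−1/(Nτ)) = −N τ² · E₂^{(N)}(τ); that is, E₂^{(N)} is anti-invariant under the Fricke involution τ ↦ −1/(Nτ). -/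
open Complex UpperHalfPlane Matrix MatrixGroups Filter

lemma E2_eq_lib (z : ℍ) : E2 (z : ℂ) = EisensteinSeries.E2 z := by
  rw [EisensteinSeries.E2_eq_tsum_cexp]
  simp [E2, sigma', qExp, ArithmeticFunction.sigma_apply]

lemma summable_aux (z : ℍ) :
    Summable fun n : ℕ+ => (sigma' 1 n : ℂ) * qExp (z : ℂ) ^ (n : ℕ) := by
  have h := (EisensteinSeries.summable_sigma_mul_cexp_pow (k := 2) one_le_two z)
  have h2 := h.comp_injective PNat.coe_injective
  refine h2.congr fun n => ?_
  simp [sigma', qExp, ArithmeticFunction.sigma_apply]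

lemma E2_S_transform (z : ℍ) :
    E2 (-1 / (z : ℂ)) = (z : ℂ) ^ 2 * E2 (z : ℂ) - 6 * Complex.I * z / Real.pi := by
  have hE2 := congrFun (EisensteinSeries.E2_slash_action ModularGroup.S) z
  simp only [Pi.sub_apply, Pi.smul_apply, EisensteinSeries.D2_S, smul_eq_mul, riemannZeta_two,
    ModularForm.SL_slash_def, modular_S_smul, ModularGroup.denom_S, Int.reduceNeg, _root_.zpow_neg] at hE2
  rw [← E2_eq_lib, ← E2_eq_lib] at hE2
  have hz : (z : ℂ) ≠ 0 := z.ne_zero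
  have hpi : (Real.pi : ℂ) ≠ 0 := by exact_mod_cast Real.pi_ne_zero
  have e : (-1 / (z : ℂ)) = (-(z : ℂ))⁻¹ := by rw [neg_div, one_div, inv_neg]
  rw [e]
  change E2 ((-(z : ℂ))⁻¹) * _ = _ at hE2
  rw [← div_eq_mul_inv, div_eq_iff (zpow_ne_zero _ hz)] at hE2
  rw [hE2, zpow_ofNat]
  field_simp

lemma E2N_eq (N : ℕ) (z w : ℍ) (hw : (w : ℂ) = N * z) :
    E2N N (z : ℂ) = (N * E2 (w : ℂ) - E2 (z : ℂ)) / 24 := by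
  have hq (n : ℕ) : qExp (z : ℂ) ^ (N * n) = qExp (w : ℂ) ^ n := by
    rw [pow_mul, qExp, qExp, ← Complex.exp_nat_mul, hw]
    congr 2
    ring
  have h : (fun n : ℕ+ => (sigma' 1 n : ℂ) *
      (qExp (z : ℂ) ^ (n : ℕ) - (N : ℂ) * qExp (z : ℂ) ^ (N * (n : ℕ)))) = fun n : ℕ+ =>
      (sigma' 1 n : ℂ) * qExp (z : ℂ) ^ (n : ℕ) -
        N * ((sigma' 1 n : ℂ) * qExp (w : ℂ) ^ (n : ℕ)) := by
    funext n
    rw [hq]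
    ring
  rw [E2N, h, (summable_aux z).tsum_sub ((summable_aux w).mul_left _), tsum_mul_left, E2, E2]
  ring

/-- `E₂^{(N)}` is anti-invariant under the Fricke involution `τ ↦ −1/(Nτ)`. -/
theorem E2N_fricke_anti_invariant (N : ℕ) (hN : 2 ≤ N) (τ : ℍ) :
    E2N N (-1 / ((N : ℂ) * τ)) = -(N : ℂ) * (τ : ℂ) ^ 2 * E2N N (τ : ℂ) := by
  have hN0 : (N : ℂ) ≠ 0 := by
    have : N ≠ 0 := by omega
    exact_mod_cast this
  have hNpos : (0 : ℝ) < N := by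
    have : 0 < N := by omega
    exact_mod_cast this
  have hτ : (τ : ℂ) ≠ 0 := τ.ne_zero
  let w : ℍ := ⟨(N : ℂ) * τ, by simpa using mul_pos hNpos τ.im_pos⟩
  have hw : (w : ℂ) = N * τ := rfl
  let u : ℍ := ⟨(-(w : ℂ))⁻¹, w.im_inv_neg_coe_pos⟩
  let v : ℍ := ⟨(-(τ : ℂ))⁻¹, τ.im_inv_neg_coe_pos⟩
  have hu : (u : ℂ) = -1 / (w : ℂ) := by
    change (-(w : ℂ))⁻¹ = _
    rw [neg_div, one_div, inv_neg]
  have hv : (v : ℂ) = -1 / (τ : ℂ) := by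
    change (-(τ : ℂ))⁻¹ = _
    rw [neg_div, one_div, inv_neg]
  have hvu : (v : ℂ) = N * u := by
    rw [hu, hv, hw]
    field_simp
  rw [← hw, ← hu, E2N_eq N u v hvu, E2N_eq N τ w hw, hu, hv, E2_S_transform, E2_S_transform, hw]
  ring
end

section
/- For every γ = [[a,b],[c,d]] ∈ SL₂(ℤ) and every τ in the complex upper half-plane, E₂((aτ+b)/(cτ+d)) = (cτ+d)² · E₂(τ) + 6c(cτ+d)/(πi), where i is the imaginary unit; that is, E₂ satisfies the quasi-modular transformation law of weight 2. -/
open Complex UpperHalfPlane Matrix MatrixGroups Filter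

lemma E2_coe_eq (z : ℍ) : E2 (z : ℂ) = 3 / (Real.pi : ℂ) ^ 2 * EisensteinSeries.G2 z := by
  have hpi : (Real.pi : ℂ) ≠ 0 := by exact_mod_cast Real.pi_ne_zero
  rw [EisensteinSeries.G2_eq_tsum_cexp, riemannZeta_two, E2]
  have h : ∀ n : ℕ+, (sigma' 1 n : ℂ) * qExp z ^ (n : ℕ) =
      (ArithmeticFunction.sigma 1 (n : ℕ) : ℂ) * cexp (2 * Real.pi * Complex.I * z) ^ (n : ℕ) := by
    intro n
    rw [ArithmeticFunction.sigma_apply, sigma', qExp]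
  rw [tsum_congr h]
  field_simp
  try ring

/-- The quasi-modular transformation law of weight `2` for `E₂` under `SL(2, ℤ)`. -/
theorem E2_quasimodular (γ : SL(2, ℤ)) (τ : ℍ) :
    E2 ((((γ 0 0 : ℤ) : ℂ) * τ + ((γ 0 1 : ℤ) : ℂ)) /
        (((γ 1 0 : ℤ) : ℂ) * τ + ((γ 1 1 : ℤ) : ℂ))) =
      (((γ 1 0 : ℤ) : ℂ) * τ + ((γ 1 1 : ℤ) : ℂ)) ^ 2 * E2 (τ : ℂ) +
        6 * ((γ 1 0 : ℤ) : ℂ) * (((γ 1 0 : ℤ) : ℂ) * τ + ((γ 1 1 : ℤ) : ℂ)) /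
          ((Real.pi : ℂ) * Complex.I) := by
  have hpi : (Real.pi : ℂ) ≠ 0 := by exact_mod_cast Real.pi_ne_zero
  have hd := UpperHalfPlane.denom_ne_zero γ τ
  have key := congrFun (EisensteinSeries.G2_slash_action γ) τ
  have hc : (((γ • τ : ℍ)) : ℂ) = (((γ 0 0 : ℤ) : ℂ) * τ + ((γ 0 1 : ℤ) : ℂ)) /
        (((γ 1 0 : ℤ) : ℂ) * τ + ((γ 1 1 : ℤ) : ℂ)) := by
    rw [UpperHalfPlane.coe_specialLinearGroup_apply]
    simp
  rw [← hc, E2_coe_eq, E2_coe_eq]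
  rw [ModularForm.SL_slash_apply, Pi.sub_apply, EisensteinSeries.D2] at key
  rw [ModularGroup.denom_apply] at key hd
  generalize ((γ 1 0 : ℤ) : ℂ) * τ + ((γ 1 1 : ℤ) : ℂ) = w at *
  have hG : EisensteinSeries.G2 (γ • τ) = w ^ 2 * (EisensteinSeries.G2 τ -
      2 * Real.pi * Complex.I * ((γ 1 0 : ℤ) : ℂ) / w) := by
    rw [← key, _root_.zpow_neg]
    norm_cast
    field_simp
  rw [hG]
  field_simp
  linear_combination (-6 * Real.pi * ((γ 1 0 : ℤ) : ℂ)) * I_sq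
end
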